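/- Let A be a finite-length heart of a bounded t-structure, and suppose a₀, ..., a_{N-1} is a sequence of objects of A such that each a_i lies in A and is simple in the iterated tilt A_i = L_{a_{i-1}} ⋯ L_{a_0} A. Then the extension-closure T = ⟨a₀, ..., a_{N-1}⟩ is a torsion class in A and the iterated simple left tilt L_{a_{N-1}} ⋯ L_{a_0} A equals the single left tilt L_T A. -/

import Mathlib

open CategoryTheory Category Limits Pretriangulated

universe v u

variable (C : Type u) [Category.{v} C] [HasZeroObject C] [HasShift C ℤ]
  [Preadditive C] [∀ n : ℤ, (CategoryTheory.shiftFunctor C n).Additive] [Pretriangulated C]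

namespace Paper

/-- The right perpendicular of a set of objects. -/
def perpSet (D : Set C) : Set C := {c | ∀ d ∈ D, ∀ φ : d ⟶ c, φ = 0}

/-- A `t`-structure given by its aisle `D`. -/
structure IsTStructure (D : Set C) : Prop where
  isoClosed : ∀ {x y : C}, (x ≅ y) → x ∈ D → y ∈ D
  shift_mem : ∀ d ∈ D, d⟦(1 : ℤ)⟧ ∈ D
  exists_triangle : ∀ c : C, ∃ d ∈ D, ∃ d' ∈ perpSet C D,
    ∃ (f : d ⟶ c) (g : c ⟶ d') (h : d' ⟶ d⟦(1 : ℤ)⟧),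
      Triangle.mk f g h ∈ distTriang C

/-- The shift `S[n]` of a set of objects. -/
def shiftSet (S : Set C) (n : ℤ) : Set C := {c | c⟦(-n : ℤ)⟧ ∈ S}

/-- The heart `D ∩ D^⊥[1]` of a `t`-structure. -/
def heartSet (D : Set C) : Set C := {c | c ∈ D ∧ c⟦(-1 : ℤ)⟧ ∈ perpSet C D}

/-- Boundedness: every object lies in `D[-n] ∩ D^⊥[n]` for some `n`. -/
def IsBounded (D : Set C) : Prop :=
  ∀ c : C, ∃ n : ℕ, c⟦(n : ℤ)⟧ ∈ D ∧ c⟦(-(n : ℤ))⟧ ∈ perpSet C D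

/-- A short exact sequence `0 → t → a → f → 0` in the heart `A`, encoded as a
distinguished triangle `t → a → f → t[1]` whose objects all lie in `A`. -/
def heartTriangle (A : Set C) (t a f : C) : Prop :=
  t ∈ A ∧ a ∈ A ∧ f ∈ A ∧
    ∃ (i : t ⟶ a) (p : a ⟶ f) (h : f ⟶ t⟦(1 : ℤ)⟧), Triangle.mk i p h ∈ distTriang C

/-- `x` is a simple object of the heart `A`. -/
def SimpleIn (A : Set C) (x : C) : Prop :=
  x ∈ A ∧ ¬ IsZero x ∧ ∀ t f : C, heartTriangle C A t x f → IsZero t ∨ IsZero f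

/-- The extension-closed subcategory of `C` generated by `S`. -/
inductive ExtClosure (S : Set C) : C → Prop
  | of {c : C} (h : c ∈ S) : ExtClosure S c
  | zero {c : C} (h : IsZero c) : ExtClosure S c
  | iso {x y : C} (e : x ≅ y) (h : ExtClosure S x) : ExtClosure S y
  | ext {a b c : C} (f : a ⟶ b) (g : b ⟶ c) (h : c ⟶ a⟦(1 : ℤ)⟧)
      (hT : Triangle.mk f g h ∈ distTriang C)
      (ha : ExtClosure S a) (hc : ExtClosure S c) : ExtClosure S b

/-- The extension closure of `S` inside the heart `A`. -/
inductive HeartExt (A : Set C) (S : Set C) : C → Prop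
  | of {c : C} (h : c ∈ S) : HeartExt A S c
  | zero {c : C} (h : IsZero c) (hA : c ∈ A) : HeartExt A S c
  | iso {x y : C} (e : x ≅ y) (hy : y ∈ A) (h : HeartExt A S x) : HeartExt A S y
  | ext {t a f : C} (ht : HeartExt A S t) (hf : HeartExt A S f)
      (h : heartTriangle C A t a f) : HeartExt A S a

/-- A torsion pair `(T, F)` in the heart `A`. -/
structure TorsionPairIn (A T F : Set C) : Prop where
  subT : T ⊆ A
  subF : F ⊆ A
  isoT : ∀ {x y : C}, (x ≅ y) → x ∈ T → y ∈ T
  isoF : ∀ {x y : C}, (x ≅ y) → x ∈ F → y ∈ F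
  hom_zero : ∀ t ∈ T, ∀ f ∈ F, ∀ φ : t ⟶ f, φ = 0
  exists_ses : ∀ a ∈ A, ∃ t ∈ T, ∃ f ∈ F, heartTriangle C A t a f

/-- The perpendicular of `T` taken inside the heart `A`. -/
def perpIn (A T : Set C) : Set C := {a | a ∈ A ∧ ∀ t ∈ T, ∀ φ : t ⟶ a, φ = 0}

/-- The left tilt `⟨F, T[-1]⟩` of the heart `A` at a torsion class `T` (with `F = T^⊥ ∩ A`). -/
def leftTilt (A T : Set C) : Set C :=
  {c | ExtClosure C (perpIn C A T ∪ shiftSet C T (-1)) c}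

/-- Objects of the heart `A` with a finite composition series. -/
inductive FiniteLengthIn (A : Set C) : C → Prop
  | zero {a : C} (h : IsZero a) : FiniteLengthIn A a
  | step {s a q : C} (hs : SimpleIn C A s) (hq : FiniteLengthIn A q)
      (ht : heartTriangle C A s a q) : FiniteLengthIn A a

set_option linter.unusedSectionVars false

section Triangles

variable {C}

/-- Every morphism from `X` to `Y` vanishes. -/
def HomZero (X Y : C) : Prop := ∀ φ : X ⟶ Y, φ = 0

/-- `X`, `Y`, `Z` are the objects of a distinguished triangle `X ⟶ Y ⟶ Z ⟶ X⟦1⟧`. -/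
def IsTri (X Y Z : C) : Prop :=
  ∃ (f : X ⟶ Y) (g : Y ⟶ Z) (h : Z ⟶ X⟦(1 : ℤ)⟧), Triangle.mk f g h ∈ distTriang C

lemma HomZero.of_iso {X Y X' Y' : C} (h : HomZero X Y) (e : X' ≅ X) (e' : Y' ≅ Y) :
    HomZero X' Y' := fun φ ↦ by
  have := h (e.inv ≫ φ ≫ e'.hom)
  rw [← cancel_epi e.inv, ← cancel_mono e'.hom]
  simpa using this

lemma HomZero.shift {X Y : C} (h : HomZero X Y) (n : ℤ) : HomZero (X⟦n⟧) (Y⟦n⟧) := fun φ ↦ by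
  obtain ⟨ψ, rfl⟩ := (CategoryTheory.shiftFunctor C n).map_surjective φ
  rw [h ψ, Functor.map_zero]

lemma HomZero.of_isZero_left {X : C} (h : IsZero X) (Y : C) : HomZero X Y :=
  fun _ ↦ h.eq_of_src _ _

/-- The isomorphism `X⟦a⟧⟦b⟧ ≅ X⟦c⟧` when `a + b = c`. -/
noncomputable def shiftShiftIso (X : C) (a b c : ℤ) (h : a + b = c) : (X⟦a⟧)⟦b⟧ ≅ X⟦c⟧ :=
  ((shiftFunctorAdd' C a b c h).app X).symm

/-- The isomorphism `X⟦a⟧⟦b⟧ ≅ X` when `a + b = 0`. -/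
noncomputable def shiftNegIso (X : C) (a b : ℤ) (h : a + b = 0) : (X⟦a⟧)⟦b⟧ ≅ X :=
  (shiftFunctorCompIsoId C a b h).app X

lemma IsTri.shift {X Y Z : C} (h : IsTri X Y Z) (n : ℤ) :
    IsTri (X⟦n⟧) (Y⟦n⟧) (Z⟦n⟧) := by
  obtain ⟨f, g, k, hT⟩ := h
  exact ⟨_, _, _, Triangle.shift_distinguished _ hT n⟩

lemma IsTri.rot {X Y Z : C} (h : IsTri X Y Z) : IsTri Y Z (X⟦(1 : ℤ)⟧) := by
  obtain ⟨f, g, k, hT⟩ := h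
  exact ⟨_, _, _, rot_of_distTriang _ hT⟩

lemma IsTri.invRot {X Y Z : C} (h : IsTri X Y Z) : IsTri (Z⟦(-1 : ℤ)⟧) X Y := by
  obtain ⟨f, g, k, hT⟩ := h
  exact ⟨_, _, _, inv_rot_of_distTriang _ hT⟩

lemma IsTri.homZero_left {X Y Z W : C} (h : IsTri X Y Z) (hX : HomZero W X) (hZ : HomZero W Z) :
    HomZero W Y := fun φ ↦ by
  obtain ⟨f, g, k, hT⟩ := h
  obtain ⟨ψ, hψ⟩ := Triangle.coyoneda_exact₂ _ hT φ (hZ _)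
  exact hψ.trans (by rw [show ψ = 0 from hX ψ]; exact zero_comp)

lemma IsTri.homZero_right {X Y Z W : C} (h : IsTri X Y Z) (hX : HomZero X W) (hZ : HomZero Z W) :
    HomZero Y W := fun φ ↦ by
  obtain ⟨f, g, k, hT⟩ := h
  obtain ⟨ψ, hψ⟩ := Triangle.yoneda_exact₂ _ hT φ (hX _)
  exact hψ.trans (by rw [show ψ = 0 from hZ ψ]; exact comp_zero)

lemma IsTri.nonempty_iso₁₂ {X Y Z : C} (h : IsTri X Y Z) (hYZ : HomZero Y Z)
    (hXZ : HomZero (X⟦(1 : ℤ)⟧) Z) : Nonempty (X ≅ Y) := by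
  have hZ : IsZero Z := (IsZero.iff_id_eq_zero _).2 (h.rot.homZero_right hYZ hXZ _)
  obtain ⟨f, g, k, hT⟩ := h
  have : IsIso f := (Triangle.isZero₃_iff_isIso₁ _ hT).1 hZ
  exact ⟨asIso f⟩

lemma isTri_of_isZero_left {X Y : C} (hX : IsZero X) : IsTri X Y Y :=
  ⟨0, 𝟙 Y, 0, (Triangle.distinguished_iff_of_isZero₁ _ hX).2 (inferInstanceAs (IsIso (𝟙 _)))⟩

end Triangles

section TStructure

variable {C} {D : Set C} (hD : IsTStructure C D)

lemma perpSet_of_isTri {D : Set C} {X Y Z : C} (h : IsTri X Y Z) (hX : X ∈ perpSet C D)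
    (hZ : Z ∈ perpSet C D) : Y ∈ perpSet C D :=
  fun d hd ↦ h.homZero_left (hX d hd) (hZ d hd)

lemma perpSet_of_iso {D : Set C} {X Y : C} (e : X ≅ Y) (hX : X ∈ perpSet C D) :
    Y ∈ perpSet C D :=
  fun d hd ↦ HomZero.of_iso (hX d hd) (Iso.refl d) e.symm

include hD

namespace IsTStructure

lemma perpSet_shift {X : C} (hX : X ∈ perpSet C D) : X⟦(-1 : ℤ)⟧ ∈ perpSet C D :=
  fun d hd ↦ ((show HomZero _ _ from hX _ (hD.shift_mem d hd)).shift (-1)).of_iso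
    (shiftNegIso d 1 (-1) (by simp)).symm (Iso.refl _)

lemma mem_of_homZero {X : C} (h : ∀ Y ∈ perpSet C D, HomZero X Y) : X ∈ D := by
  obtain ⟨d, hd, d', hd', f, g, k, hT⟩ := hD.exists_triangle X
  obtain ⟨e⟩ := IsTri.nonempty_iso₁₂ ⟨f, g, k, hT⟩ (h _ hd') (hd' _ (hD.shift_mem _ hd))
  exact hD.isoClosed e hd

lemma mem_of_isTri {X Y Z : C} (h : IsTri X Y Z) (hX : X ∈ D) (hZ : Z ∈ D) : Y ∈ D :=
  hD.mem_of_homZero fun _ hW ↦ h.homZero_right (hW _ hX) (hW _ hZ)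

lemma heart_of_isTri {X Y Z : C} (h : IsTri X Y Z) (hX : X ∈ heartSet C D)
    (hZ : Z ∈ heartSet C D) : Y ∈ heartSet C D :=
  ⟨hD.mem_of_isTri h hX.1 hZ.1, perpSet_of_isTri (h.shift (-1)) hX.2 hZ.2⟩

lemma heart_of_iso {X Y : C} (e : X ≅ Y) (hX : X ∈ heartSet C D) : Y ∈ heartSet C D :=
  ⟨hD.isoClosed e hX.1,
    perpSet_of_iso ((CategoryTheory.shiftFunctor C (-1 : ℤ)).mapIso e) hX.2⟩

lemma heart_of_isZero {X : C} (h : IsZero X) : X ∈ heartSet C D :=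
  ⟨hD.mem_of_homZero fun Y _ ↦ HomZero.of_isZero_left h Y,
    fun _ _ _ ↦ (Functor.map_isZero (CategoryTheory.shiftFunctor C (-1 : ℤ)) h).eq_of_tgt _ _⟩

lemma perpSet_shift_neg {X : C} (hX : X⟦(-1 : ℤ)⟧ ∈ perpSet C D) (n : ℕ) :
    X⟦(-(n + 1 : ℕ) : ℤ)⟧ ∈ perpSet C D := by
  induction n with
  | zero => simpa using hX
  | succ n ih =>
    exact perpSet_of_iso (shiftShiftIso X _ (-1) _ (by push_cast; ring)) (hD.perpSet_shift ih)

lemma heart_homZero_shift {X Y : C} (hX : X ∈ heartSet C D) (hY : Y ∈ heartSet C D)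
    {n : ℤ} (hn : n < 0) : HomZero X (Y⟦n⟧) := by
  obtain ⟨m, rfl⟩ : ∃ m : ℕ, n = -(m + 1 : ℕ) := ⟨(-n - 1).toNat, by lia⟩
  exact hD.perpSet_shift_neg hY.2 m _ hX.1

lemma heart_homZero_one {X Y : C} (hX : X ∈ heartSet C D) (hY : Y ∈ heartSet C D) :
    HomZero (X⟦(1 : ℤ)⟧) Y :=
  ((hD.heart_homZero_shift hX hY (n := -1) (by lia)).shift 1).of_iso (Iso.refl _)
    (shiftNegIso Y (-1) 1 (by simp)).symm

/-- Every object with cohomology in two consecutive degrees is an extension of objects of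
the shifted hearts. -/
lemma exists_isTri_of_mem {c : C} (h₁ : c⟦(1 : ℤ)⟧ ∈ D) (h₂ : c⟦(-1 : ℤ)⟧ ∈ perpSet C D) :
    ∃ d d' : C, IsTri d c d' ∧ d ∈ heartSet C D ∧ d'⟦(1 : ℤ)⟧ ∈ heartSet C D ∧
      d' ∈ perpSet C D := by
  obtain ⟨d, hd, d', hd', f, g, k, hT⟩ := hD.exists_triangle c
  have hT : IsTri d c d' := ⟨f, g, k, hT⟩
  refine ⟨d, d', hT, ⟨hd, perpSet_of_isTri (hT.invRot.shift (-1))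
    (hD.perpSet_shift (hD.perpSet_shift hd')) h₂⟩,
    ⟨hD.mem_of_isTri (hT.rot.shift 1) h₁ (hD.shift_mem _ (hD.shift_mem _ hd)),
      perpSet_of_iso (shiftNegIso d' 1 (-1) (by simp)).symm hd'⟩, hd'⟩

end IsTStructure

end TStructure

section Tilt

variable {C}

lemma heartTriangle.isTri {A : Set C} {t a f : C} (h : heartTriangle C A t a f) : IsTri t a f :=
  h.2.2.2

lemma IsTri.heartTriangle {A : Set C} {t a f : C} (h : IsTri t a f) (ht : t ∈ A) (ha : a ∈ A)
    (hf : f ∈ A) : heartTriangle C A t a f :=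
  ⟨ht, ha, hf, h⟩

lemma ExtClosure.of_isTri {S : Set C} {a b c : C} (h : IsTri a b c) (ha : ExtClosure C S a)
    (hc : ExtClosure C S c) : ExtClosure C S b := by
  obtain ⟨f, g, k, hT⟩ := h
  exact .ext f g k hT ha hc

lemma ExtClosure.bind {S S' : Set C} (h : ∀ x ∈ S, ExtClosure C S' x) {x : C}
    (hx : ExtClosure C S x) : ExtClosure C S' x := by
  induction hx with
  | of hc => exact h _ hc
  | zero hc => exact .zero hc
  | iso e _ ih => exact .iso e ih
  | ext f g k hT _ _ iha ihc => exact .ext f g k hT iha ihc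

lemma HeartExt.mono {A S S' : Set C} (h : S ⊆ S') {x : C} (hx : HeartExt C A S x) :
    HeartExt C A S' x := by
  induction hx with
  | of hc => exact .of (h hc)
  | zero hc hA => exact .zero hc hA
  | iso e hy _ ih => exact .iso e hy ih
  | ext _ _ hT iht ihf => exact .ext iht ihf hT

lemma HeartExt.mem {A S : Set C} (h : S ⊆ A) {x : C} (hx : HeartExt C A S x) : x ∈ A := by
  induction hx with
  | of hc => exact h hc
  | zero hc hA => exact hA
  | iso e hy _ ih => exact hy
  | ext _ _ hT iht ihf => exact hT.2.1

lemma HeartExt.homZero {A S : Set C} {Y : C} (h : ∀ s ∈ S, HomZero s Y) {x : C}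
    (hx : HeartExt C A S x) : HomZero x Y := by
  induction hx with
  | of hc => exact h _ hc
  | zero hc hA => exact .of_isZero_left hc Y
  | iso e _ _ ih => exact ih.of_iso e.symm (Iso.refl _)
  | ext _ _ hT iht ihf => exact hT.isTri.homZero_right iht ihf

lemma HeartExt.extClosure_shift {A S S' : Set C} (n : ℤ)
    (h : ∀ s ∈ S, ExtClosure C S' (s⟦n⟧)) {x : C} (hx : HeartExt C A S x) :
    ExtClosure C S' (x⟦n⟧) := by
  induction hx with
  | of hc => exact h _ hc
  | zero hc hA => exact .zero (Functor.map_isZero _ hc)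
  | iso e _ _ ih => exact .iso ((CategoryTheory.shiftFunctor C n).mapIso e) ih
  | ext _ _ hT iht ihf => exact .of_isTri (hT.isTri.shift n) iht ihf

lemma mem_shiftSet_neg_one {S : Set C} {c : C} : c ∈ shiftSet C S (-1) ↔ c⟦(1 : ℤ)⟧ ∈ S :=
  Iff.rfl

lemma shift_mem_shiftSet {S : Set C} (hS : ∀ {x y : C}, (x ≅ y) → x ∈ S → y ∈ S) {x : C}
    (hx : x ∈ S) : x⟦(-1 : ℤ)⟧ ∈ shiftSet C S (-1) :=
  mem_shiftSet_neg_one.2 (hS (shiftNegIso x (-1) 1 (by simp)).symm hx)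

variable {D T F : Set C} (hD : IsTStructure C D)

lemma TorsionPairIn.mem_perpIn {A : Set C} (hT : TorsionPairIn C A T F) {f : C} (hf : f ∈ F) :
    f ∈ perpIn C A T :=
  ⟨hT.subF hf, fun t ht ↦ hT.hom_zero t ht f hf⟩

include hD

lemma TorsionPairIn.mem_of_homZero (hT : TorsionPairIn C (heartSet C D) T F) {x : C}
    (hx : x ∈ heartSet C D) (h : ∀ f ∈ perpIn C (heartSet C D) T, HomZero x f) : x ∈ T := by
  obtain ⟨t, ht, f, hf, hE⟩ := hT.exists_ses x hx
  obtain ⟨e⟩ := hE.isTri.nonempty_iso₁₂ (h f (hT.mem_perpIn hf))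
    (hD.heart_homZero_one hE.1 hE.2.2.1)
  exact hT.isoT e ht

/-- A cohomological description of the left tilt. -/
lemma leftTilt_conditions (hT : T ⊆ heartSet C D) {c : C}
    (hc : c ∈ leftTilt C (heartSet C D) T) :
    c⟦(1 : ℤ)⟧ ∈ D ∧ c⟦(-1 : ℤ)⟧ ∈ perpSet C D ∧ (∀ t ∈ T, HomZero t c) ∧
      ∀ f ∈ perpIn C (heartSet C D) T, HomZero (c⟦(1 : ℤ)⟧) f := by
  induction hc with
  | @of c hc =>
    rcases hc with hc | hc
    · exact ⟨hD.shift_mem _ hc.1.1, hc.1.2, hc.2, fun f hf ↦ hD.heart_homZero_one hc.1 hf.1⟩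
    · rw [mem_shiftSet_neg_one] at hc
      have e : c ≅ (c⟦(1 : ℤ)⟧)⟦(-1 : ℤ)⟧ := (shiftNegIso c 1 (-1) (by simp)).symm
      exact ⟨(hT hc).1, hD.perpSet_shift (perpSet_of_iso e.symm (hT hc).2),
        fun t ht ↦ (hD.heart_homZero_shift (hT ht) (hT hc) (by lia)).of_iso (Iso.refl _) e,
        fun f hf ↦ hf.2 _ hc⟩
  | zero hc =>
    have h₁ := Functor.map_isZero (CategoryTheory.shiftFunctor C (1 : ℤ)) hc
    exact ⟨(hD.heart_of_isZero h₁).1, (hD.heart_of_isZero hc).2,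
      fun t _ _ ↦ hc.eq_of_tgt _ _, fun f _ ↦ .of_isZero_left h₁ f⟩
  | iso e _ ih =>
    have e₁ := (CategoryTheory.shiftFunctor C (1 : ℤ)).mapIso e
    exact ⟨hD.isoClosed e₁ ih.1,
      perpSet_of_iso ((CategoryTheory.shiftFunctor C (-1 : ℤ)).mapIso e) ih.2.1,
      fun t ht ↦ (ih.2.2.1 t ht).of_iso (Iso.refl _) e.symm,
      fun f hf ↦ (ih.2.2.2 f hf).of_iso e₁.symm (Iso.refl _)⟩
  | ext f g k hE _ _ iha ihc =>
    have h : IsTri _ _ _ := ⟨f, g, k, hE⟩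
    exact ⟨hD.mem_of_isTri (h.shift 1) iha.1 ihc.1,
      perpSet_of_isTri (h.shift (-1)) iha.2.1 ihc.2.1,
      fun t ht ↦ h.homZero_left (iha.2.2.1 t ht) (ihc.2.2.1 t ht),
      fun f hf ↦ (h.shift 1).homZero_right (iha.2.2.2 f hf) (ihc.2.2.2 f hf)⟩

lemma exists_isTri_of_mem_leftTilt (hT : TorsionPairIn C (heartSet C D) T F) {c : C}
    (hc : c ∈ leftTilt C (heartSet C D) T) :
    ∃ f ∈ perpIn C (heartSet C D) T, ∃ t ∈ shiftSet C T (-1), IsTri f c t := by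
  obtain ⟨h₁, h₂, h₃, h₄⟩ := leftTilt_conditions hD hT.subT hc
  obtain ⟨d, d', hE, hd, hd₁, hd'⟩ := hD.exists_isTri_of_mem h₁ h₂
  refine ⟨d, ⟨hd, fun t ht ↦ ?_⟩, d', ?_, hE⟩
  · exact hE.invRot.homZero_left (hD.perpSet_shift hd' t (hT.subT ht).1) (h₃ t ht)
  · refine hT.mem_of_homZero hD hd₁ fun f hf ↦ ?_
    exact (hE.rot.shift 1).homZero_right (h₄ f hf)
      ((HomZero.shift (hf.1.2 _ (hD.shift_mem _ hd.1)) 1).of_iso (Iso.refl _)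
        (shiftNegIso f (-1) 1 (by simp)).symm)

lemma mem_perpIn_of_mem_leftTilt (hT : T ⊆ heartSet C D) {c : C}
    (hc : c ∈ leftTilt C (heartSet C D) T) (hc' : c ∈ heartSet C D) :
    c ∈ perpIn C (heartSet C D) T :=
  ⟨hc', (leftTilt_conditions hD hT hc).2.2.1⟩

/-- Tilting at `⟨S⟩` and then at an object `a` of the heart is tilting at `⟨S, a⟩`. -/
lemma leftTilt_leftTilt {S : Set C} {a : C} (hS : S ⊆ heartSet C D) (ha : a ∈ heartSet C D)
    (hT : TorsionPairIn C (heartSet C D) {c | HeartExt C (heartSet C D) S c} F)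
    (ha' : a ∈ leftTilt C (heartSet C D) {c | HeartExt C (heartSet C D) S c}) :
    leftTilt C (leftTilt C (heartSet C D) {c | HeartExt C (heartSet C D) S c})
        {c | HeartExt C (leftTilt C (heartSet C D) {c | HeartExt C (heartSet C D) S c}) {a} c} =
      leftTilt C (heartSet C D) {c | HeartExt C (heartSet C D) (insert a S) c} := by
  set A := heartSet C D
  set T₀ : Set C := {c | HeartExt C A S c}
  set B := leftTilt C A T₀
  have haS : insert a S ⊆ A := Set.insert_subset ha hS
  have isoT {x y : C} (e : x ≅ y) (hx : HeartExt C A (insert a S) x) :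
      HeartExt C A (insert a S) y := .iso e (hD.heart_of_iso e (hx.mem haS)) hx
  ext c
  constructor
  · refine ExtClosure.bind ?_
    rintro x (⟨hxB, hx⟩ | hx)
    · obtain ⟨f, hf, t, ht, hE⟩ := exists_isTri_of_mem_leftTilt hD hT hxB
      rw [mem_shiftSet_neg_one] at ht
      refine .of_isTri hE (.of (.inl ⟨hf.1, fun t' ht' ↦ ?_⟩)) (.of (.inr ?_))
      · refine HeartExt.homZero ?_ ht'
        rintro s (rfl | hs)
        · refine hE.invRot.homZero_left ?_ (hx s (.of rfl))
          exact (hD.heart_homZero_shift ha (hT.subT ht) (n := -2) (by lia)).of_iso (Iso.refl _)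
            ((CategoryTheory.shiftFunctor C (-1 : ℤ)).mapIso
              (shiftNegIso t 1 (-1) (by simp)).symm ≪≫ shiftShiftIso _ (-1) (-1) (-2) (by simp))
        · exact hf.2 s (.of hs)
      · exact mem_shiftSet_neg_one.2 (HeartExt.mono (Set.subset_insert a S) ht)
    · rw [mem_shiftSet_neg_one] at hx
      refine .iso (shiftNegIso x 1 (-1) (by simp)) (HeartExt.extClosure_shift (-1) ?_ hx)
      rintro s rfl
      exact .of (.inr (shift_mem_shiftSet isoT (.of (Set.mem_insert s S))))
  · refine ExtClosure.bind ?_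
    rintro x (hx | hx)
    · refine .of (.inl ⟨.of (.inl ⟨hx.1, fun t ht ↦ hx.2 t ?_⟩), fun t ht ↦ ?_⟩)
      · exact HeartExt.mono (Set.subset_insert a S) ht
      · refine HeartExt.homZero ?_ ht
        rintro s rfl
        exact hx.2 s (.of (Set.mem_insert s S))
    · rw [mem_shiftSet_neg_one] at hx
      refine .iso (shiftNegIso x 1 (-1) (by simp)) (HeartExt.extClosure_shift (-1) ?_ hx)
      rintro s (rfl | hs)
      · refine .of (.inr (mem_shiftSet_neg_one.2 (.iso (shiftNegIso s (-1) 1 (by simp)).symm ?_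
          (.of rfl))))
        exact ExtClosure.iso (shiftNegIso s (-1) 1 (by simp)).symm ha'
      · refine .of (.inl ⟨.of (.inr (shift_mem_shiftSet hT.isoT (.of hs))), fun t ht ↦ ?_⟩)
        refine HeartExt.homZero ?_ ht
        rintro _ rfl
        exact hD.heart_homZero_shift ha (hS hs) (by lia)

end Tilt

section Heart

variable {C} {D : Set C}

lemma distTriang_of_iso {X Y Z X' Y' Z' : C} {f : X ⟶ Y} {g : Y ⟶ Z} {k : Z ⟶ X⟦(1 : ℤ)⟧}
    (hT : Triangle.mk f g k ∈ distTriang C) (e₁ : X' ≅ X) (e₂ : Y' ≅ Y) (e₃ : Z' ≅ Z)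
    (f' : X' ⟶ Y') (g' : Y' ⟶ Z') (k' : Z' ⟶ X'⟦(1 : ℤ)⟧)
    (h₁ : f' ≫ e₂.hom = e₁.hom ≫ f) (h₂ : g' ≫ e₃.hom = e₂.hom ≫ g)
    (h₃ : k' ≫ e₁.hom⟦1⟧' = e₃.hom ≫ k) : Triangle.mk f' g' k' ∈ distTriang C :=
  isomorphic_distinguished _ hT _ (Triangle.isoMk _ _ e₁ e₂ e₃ h₁ h₂ h₃)

lemma IsTri.of_iso {X Y Z X' Y' Z' : C} (h : IsTri X Y Z) (e₁ : X' ≅ X) (e₂ : Y' ≅ Y)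
    (e₃ : Z' ≅ Z) : IsTri X' Y' Z' := by
  obtain ⟨f, g, k, hT⟩ := h
  exact ⟨_, _, _, distTriang_of_iso hT e₁ e₂ e₃ (e₁.hom ≫ f ≫ e₂.inv) (e₂.hom ≫ g ≫ e₃.inv)
    (e₃.hom ≫ k ≫ e₁.inv⟦1⟧') (by simp) (by simp) (by simp [← Functor.map_comp])⟩

variable (D) in
/-- The heart as a full subcategory. -/
abbrev HeartCat : Type u := ObjectProperty.FullSubcategory (C := C) (fun c ↦ c ∈ heartSet C D)

variable (D) in
/-- The inclusion of the heart. -/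
abbrev heartι : HeartCat D ⥤ C := ObjectProperty.ι _

variable (hD : IsTStructure C D)

include hD

namespace IsTStructure

open Triangulated ZeroObject

lemma heartι_eq_zero ⦃X Y : HeartCat D⦄ ⦃n : ℤ⦄
    (f : (heartι D).obj X ⟶ ((heartι D).obj Y)⟦n⟧) (hn : n < 0) : f = 0 :=
  hD.heart_homZero_shift X.property Y.property hn f

lemma admissibleMorphism_eq_top : AbelianSubcategory.admissibleMorphism (heartι D) = ⊤ := by
  ext X₁ X₂ f₁
  simp only [MorphismProperty.top_apply, iff_true]
  intro X₃ f₂ f₃ hT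
  have hT : IsTri X₁.obj X₂.obj X₃ := ⟨_, _, _, hT⟩
  have e := shiftNegIso X₃ (-1) 1 (by simp)
  obtain ⟨d, d', hE, hd, hd', -⟩ := hD.exists_isTri_of_mem (c := X₃⟦(-1 : ℤ)⟧)
    (hD.isoClosed e.symm (hD.mem_of_isTri hT.rot X₂.property.1 (hD.shift_mem _ X₁.property.1)))
    (perpSet_of_isTri ((hT.rot.shift (-1)).shift (-1)) (hD.perpSet_shift X₂.property.2)
      (perpSet_of_iso ((CategoryTheory.shiftFunctor C (-1 : ℤ)).mapIso
        (shiftNegIso X₁.obj 1 (-1) (by simp)).symm) X₁.property.2))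
  obtain ⟨α, β, γ, h⟩ := (hE.shift 1).of_iso (Iso.refl _) e.symm (Iso.refl _)
  exact ⟨⟨d, hd⟩, ⟨_, hd'⟩, α, β, γ, h⟩

lemma hasFiniteProducts_heart : HasFiniteProducts (HeartCat D) := by
  have : HasBinaryBiproducts (HeartCat D) := ⟨fun X Y ↦ by
    let b : BinaryBicone X Y :=
      { pt := ⟨X.obj ⊞ Y.obj, hD.heart_of_isTri ⟨_, _, _, binaryBiproductTriangle_distinguished _ _⟩
          X.property Y.property⟩
        fst := ⟨biprod.fst⟩
        snd := ⟨biprod.snd⟩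
        inl := ⟨biprod.inl⟩
        inr := ⟨biprod.inr⟩
        inl_fst := by ext; simp
        inl_snd := by ext; simp
        inr_fst := by ext; simp
        inr_snd := by ext; simp }
    exact hasBinaryBiproduct_of_total b (InducedCategory.hom_ext biprod.total)⟩
  have : HasTerminal (HeartCat D) := by
    refine IsTerminal.hasTerminal (X := ⟨0, hD.heart_of_isZero (isZero_zero C)⟩) ?_
    exact IsTerminal.ofUniqueHom (fun _ ↦ ⟨0⟩) fun _ _ ↦
      InducedCategory.hom_ext ((isZero_zero C).eq_of_tgt _ _)
  exact hasFiniteProducts_of_has_binary_and_terminal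

lemma exists_distTriang_of_mono {X₁ X₂ : HeartCat D} (i : X₁ ⟶ X₂) [Mono i] :
    ∃ (X₃ : HeartCat D) (p : X₂ ⟶ X₃) (δ : (heartι D).obj X₃ ⟶ ((heartι D).obj X₁)⟦(1 : ℤ)⟧),
      Triangle.mk ((heartι D).map i) ((heartι D).map p) δ ∈ distTriang C := by
  obtain ⟨X₃, f₂, f₃, hT⟩ := distinguished_cocone_triangle ((heartι D).map i)
  have : AbelianSubcategory.admissibleMorphism (heartι D) i := by
    simp [hD.admissibleMorphism_eq_top]
  obtain ⟨K, Q, α, β, γ, hT'⟩ := this f₂ f₃ hT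
  have := AbelianSubcategory.mono_ιK hD.heartι_eq_zero hT hT'
  have hK : 𝟙 K = 0 := by
    rw [← cancel_mono (AbelianSubcategory.ιK f₃ α), ← cancel_mono i, id_comp, zero_comp, zero_comp]
    exact AbelianSubcategory.ιK_mor₁ hT α
  have hK' : IsZero ((heartι D).obj K) := by
    rw [IsZero.iff_id_eq_zero, ← (heartι D).map_id, hK, (heartι D).map_zero]
  have : IsIso β := (Triangle.isZero₁_iff_isIso₂ _ hT').1 (Functor.map_isZero _ hK')
  refine ⟨Q, AbelianSubcategory.πQ f₂ β, inv β ≫ f₃, distTriang_of_iso hT (Iso.refl _)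
    (Iso.refl _) (asIso β).symm _ _ _ (by simp) ?_ (by simp)⟩
  rw [AbelianSubcategory.ι_map_πQ]
  simp

/-- The heart of a t-structure is an abelian category. -/
noncomputable abbrev heartAbelian : Abelian (HeartCat D) :=
  letI := hD.hasFiniteProducts_heart
  { toPreadditive := inferInstance
    normalMonoOfMono := fun i _ ↦ by
      obtain ⟨Q, p, δ, hT⟩ := hD.exists_distTriang_of_mono i
      exact ⟨{
        Z := Q
        g := p
        w := _
        isLimit := AbelianSubcategory.isLimitKernelForkOfDistTriang hD.heartι_eq_zero i p δ hT }⟩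
    normalEpiOfEpi := fun p _ ↦ by
      obtain ⟨K, i, δ, hT⟩ := AbelianSubcategory.exists_distinguished_triangle_of_epi
        hD.heartι_eq_zero hD.admissibleMorphism_eq_top p
      exact ⟨{
        W := K
        g := i
        w := _
        isColimit := AbelianSubcategory.isColimitCokernelCoforkOfDistTriang
          hD.heartι_eq_zero i p δ hT }⟩
    has_kernels := ⟨fun f ↦ AbelianSubcategory.hasKernel_of_admissibleMorphism
      hD.heartι_eq_zero f (by simp [hD.admissibleMorphism_eq_top])⟩
    has_cokernels := ⟨fun f ↦ AbelianSubcategory.hasCokernel_of_admissibleMorphism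
      hD.heartι_eq_zero f (by simp [hD.admissibleMorphism_eq_top])⟩ }

lemma heartTriangle_of_shortExact :
    letI := hD.heartAbelian
    ∀ {S : ShortComplex (HeartCat D)}, S.ShortExact →
      heartTriangle C (heartSet C D) S.X₁.obj S.X₂.obj S.X₃.obj := by
  let := hD.heartAbelian
  intro S hS
  have := hS.mono_f
  obtain ⟨Q, p, δ, hT⟩ := hD.exists_distTriang_of_mono S.f
  have e : S.X₃ ≅ Q := hS.gIsCokernel.coconePointUniqueUpToIso
    (AbelianSubcategory.isColimitCokernelCoforkOfDistTriang hD.heartι_eq_zero S.f p δ hT)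
  have h : IsTri S.X₁.obj S.X₂.obj Q.obj := ⟨_, _, _, hT⟩
  exact (h.of_iso (Iso.refl _) (Iso.refl _) ((heartι D).mapIso e)).heartTriangle
    S.X₁.property S.X₂.property S.X₃.property

lemma exists_shortExact :
    letI := hD.heartAbelian
    ∀ {X Y Z : HeartCat D}, IsTri X.obj Y.obj Z.obj →
      ∃ (f : X ⟶ Y) (g : Y ⟶ Z) (w : f ≫ g = 0), (ShortComplex.mk f g w).ShortExact := by
  let := hD.heartAbelian
  rintro X Y Z ⟨f, g, k, hT⟩
  have hK := AbelianSubcategory.isLimitKernelForkOfDistTriang hD.heartι_eq_zero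
    (X₁ := X) (X₂ := Y) (X₃ := Z) ⟨f⟩ ⟨g⟩ k hT
  have hQ := AbelianSubcategory.isColimitCokernelCoforkOfDistTriang hD.heartι_eq_zero
    (X₁ := X) (X₂ := Y) (X₃ := Z) ⟨f⟩ ⟨g⟩ k hT
  exact ⟨⟨f⟩, ⟨g⟩, InducedCategory.hom_ext (comp_distTriang_mor_zero₁₂ _ hT),
    { exact := ShortComplex.exact_of_f_is_kernel _ hK
      mono_f := mono_of_isLimit_fork hK
      epi_g := epi_of_isColimit_cofork hQ }⟩

end IsTStructure

end Heart

section Abelian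

variable {E : Type*} [Category* E] [Abelian E]

lemma shortExact_kernel {X Y : E} (p : X ⟶ Y) [Epi p] :
    (ShortComplex.mk (kernel.ι p) p (kernel.condition p)).ShortExact where
  exact := ShortComplex.exact_of_f_is_kernel _ (kernelIsKernel p)

lemma shortExact_cokernel {X Y : E} (i : X ⟶ Y) [Mono i] :
    (ShortComplex.mk i (cokernel.π i) (cokernel.condition i)).ShortExact where
  exact := ShortComplex.exact_of_g_is_cokernel _ (cokernelIsCokernel i)

/-- `X` has a composition series with at most `n` factors. -/
inductive HasLength : ℕ → E → Prop
  | zero {X : E} (h : IsZero X) : HasLength 0 X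
  | step {n : ℕ} {S : ShortComplex E} (hS : S.ShortExact) (h₁ : Simple S.X₁)
      (h₃ : HasLength n S.X₃) : HasLength (n + 1) S.X₂

lemma HasLength.exists_of_epi {n : ℕ} {X : E} (hX : HasLength n X) :
    ∀ {Y : E} (p : X ⟶ Y) [Epi p], ∃ m ≤ n, HasLength m Y ∧ (m = n → Mono p) := by
  induction hX with
  | zero h =>
    intro Y p _
    exact ⟨0, le_rfl, .zero (h.of_epi p), fun _ ↦ ⟨fun _ _ _ ↦ h.eq_of_tgt _ _⟩⟩
  | @step n S hS h₁ h₃ ih =>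
    intro Y p _
    have := hS.epi_g
    have := hS.mono_f
    by_cases h : S.f ≫ p = 0
    · obtain ⟨p', hp'⟩ : ∃ p' : S.X₃ ⟶ Y, S.g ≫ p' = p :=
        ⟨hS.gIsCokernel.desc (CokernelCofork.ofπ p h), hS.gIsCokernel.fac _ .one⟩
      have : Epi (S.g ≫ p') := by rwa [hp']
      have := epi_of_epi S.g p'
      obtain ⟨m, hm, hY, -⟩ := ih p'
      exact ⟨m, by lia, hY, by lia⟩
    · have : Mono (S.f ≫ p) := mono_of_nonzero_from_simple h
      obtain ⟨p', hp'⟩ : ∃ p' : S.X₃ ⟶ cokernel (S.f ≫ p), S.g ≫ p' = p ≫ cokernel.π _ :=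
        ⟨hS.gIsCokernel.desc (CokernelCofork.ofπ (p ≫ cokernel.π (S.f ≫ p)) (by
          rw [← assoc, cokernel.condition])), hS.gIsCokernel.fac _ .one⟩
      have : Epi (S.g ≫ p') := by rw [hp']; infer_instance
      have := epi_of_epi S.g p'
      obtain ⟨m, hm, hY, hmono⟩ := ih p'
      refine ⟨m + 1, by lia, .step (shortExact_cokernel (S.f ≫ p)) h₁ hY, fun hm' ↦ ?_⟩
      have := hmono (by lia)
      refine Preadditive.mono_of_cancel_zero _ fun {Z} k hk ↦ ?_
      have hk' : k ≫ S.g = 0 := by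
        rw [← cancel_mono p', assoc, hp', reassoc_of% hk, zero_comp, zero_comp]
      obtain ⟨l, rfl⟩ : ∃ l : Z ⟶ S.X₁, l ≫ S.f = k :=
        ⟨hS.fIsKernel.lift (KernelFork.ofι k hk'), hS.fIsKernel.fac _ .zero⟩
      rw [assoc] at hk
      rw [zero_of_comp_mono _ hk, zero_comp]

/-- The kernel of a composition of epimorphisms is an extension of the kernels. -/
lemma exists_shortExact_kernel_comp {X Y Z : E} (p : X ⟶ Y) (q : Y ⟶ Z) [Epi p] [Epi q] :
    ∃ (f : kernel p ⟶ kernel (p ≫ q)) (g : kernel (p ≫ q) ⟶ kernel q) (w : f ≫ g = 0),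
      (ShortComplex.mk f g w).ShortExact := by
  let f : kernel p ⟶ kernel (p ≫ q) :=
    kernel.lift _ (kernel.ι p) (by rw [kernel.condition_assoc, zero_comp])
  let g : kernel (p ≫ q) ⟶ kernel q :=
    kernel.lift _ (kernel.ι (p ≫ q) ≫ p) (by rw [assoc, kernel.condition])
  have hf : f ≫ kernel.ι (p ≫ q) = kernel.ι p := kernel.lift_ι _ _ _
  have hg : g ≫ kernel.ι q = kernel.ι (p ≫ q) ≫ p := kernel.lift_ι _ _ _
  have w : f ≫ g = 0 := by
    rw [← cancel_mono (kernel.ι q), assoc, hg, reassoc_of% hf, kernel.condition, zero_comp]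
  have : Mono (f ≫ kernel.ι (p ≫ q)) := by rw [hf]; infer_instance
  refine ⟨f, g, w, { exact := ?_, mono_f := mono_of_mono f (kernel.ι (p ≫ q)), epi_g := ?_ }⟩
  · rw [ShortComplex.exact_iff_exact_up_to_refinements]
    intro A x hx
    have hx' : x ≫ g = 0 := hx
    refine ⟨A, 𝟙 A, inferInstance, kernel.lift p (x ≫ kernel.ι (p ≫ q)) ?_, ?_⟩
    · rw [assoc, ← hg, reassoc_of% hx', zero_comp]
    · change 𝟙 A ≫ x = _ ≫ f
      rw [← cancel_mono (kernel.ι (p ≫ q)), assoc, assoc, hf, kernel.lift_ι, id_comp]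
  · change Epi g
    rw [epi_iff_surjective_up_to_refinements]
    intro A y
    obtain ⟨A', π, hπ, x, hx⟩ := surjective_up_to_refinements_of_epi p (y ≫ kernel.ι q)
    refine ⟨A', π, hπ, kernel.lift _ x ?_, ?_⟩
    · rw [← assoc, ← hx, assoc, assoc, kernel.condition, comp_zero, comp_zero]
    · rw [← cancel_mono (kernel.ι q), assoc, assoc, hg, kernel.lift_ι_assoc, hx]

/-- In an abelian category, a class of objects closed under quotients and extensions induces
a torsion decomposition of every object of finite length. -/
lemma exists_torsion_decomposition (T : Set E) (hzero : ∀ X, IsZero X → X ∈ T)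
    (hquot : ∀ ⦃X Y : E⦄ (p : X ⟶ Y) [Epi p], X ∈ T → Y ∈ T)
    (hext : ∀ ⦃S : ShortComplex E⦄, S.ShortExact → S.X₁ ∈ T → S.X₃ ∈ T → S.X₂ ∈ T)
    (n : ℕ) : ∀ X : E, HasLength n X → ∃ (F : E) (p : X ⟶ F), Epi p ∧ kernel p ∈ T ∧
      ∀ t ∈ T, ∀ φ : t ⟶ F, φ = 0 := by
  induction n using Nat.strong_induction_on with
  | _ n ih =>
    intro X hX
    by_cases h : ∀ t ∈ T, ∀ φ : t ⟶ X, φ = 0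
    · exact ⟨X, 𝟙 X, inferInstance, hzero _ ((isZero_zero E).of_iso (kernel.ofMono (𝟙 X))), h⟩
    · push Not at h
      obtain ⟨t, ht, φ, hφ⟩ := h
      obtain ⟨m, hm, hY, hmono⟩ := hX.exists_of_epi (cokernel.π φ)
      obtain rfl | hm := hm.eq_or_lt
      · have := hmono rfl
        exact absurd (zero_of_comp_mono _ (cokernel.condition φ)) hφ
      · obtain ⟨F, q, hq, hqT, hF⟩ := ih m hm _ hY
        refine ⟨F, cokernel.π φ ≫ q, inferInstance, ?_, hF⟩
        obtain ⟨f, g, w, hS⟩ := exists_shortExact_kernel_comp (cokernel.π φ) q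
        exact hext hS (hquot (Abelian.factorThruImage φ) ht) hqT

/-- A quotient of an extension is an extension of quotients. -/
lemma exists_shortExact_of_epi {S : ShortComplex E} (hS : S.ShortExact) {Y : E} (p : S.X₂ ⟶ Y)
    [Epi p] : ∃ S' : ShortComplex E, S'.ShortExact ∧ S'.X₂ = Y ∧
      (∃ q : S.X₁ ⟶ S'.X₁, Epi q) ∧ ∃ q : S.X₃ ⟶ S'.X₃, Epi q := by
  have := hS.epi_g
  refine ⟨_, shortExact_kernel (cokernel.π (S.f ≫ p)), rfl,
    ⟨Abelian.factorThruImage (S.f ≫ p), inferInstance⟩,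
    hS.gIsCokernel.desc (CokernelCofork.ofπ (p ≫ cokernel.π (S.f ≫ p)) (by
      rw [← assoc, cokernel.condition])), ?_⟩
  refine @epi_of_epi _ _ _ _ _ S.g _ ?_
  rw [show S.g ≫ _ = p ≫ cokernel.π (S.f ≫ p) from hS.gIsCokernel.fac _ .one]
  infer_instance

end Abelian

section IteratedTilt

variable {C} {D T F S : Set C} (hD : IsTStructure C D)

lemma HeartExt.isZero_of_empty {A : Set C} {x : C} (hx : HeartExt C A ∅ x) : IsZero x :=
  (IsZero.iff_id_eq_zero _).2 (HeartExt.homZero (by simp) hx _)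

include hD

namespace IsTStructure

lemma simple_of_simpleIn :
    letI := hD.heartAbelian
    ∀ {X : HeartCat D}, SimpleIn C (heartSet C D) X.obj → Simple X := by
  let := hD.heartAbelian
  intro X hX
  refine ⟨fun {Y} f _ ↦ ⟨fun _ hf ↦ hX.2.1 ?_, fun hf ↦ ?_⟩⟩
  · refine (heartι D).map_isZero (X := X) ?_
    rw [IsZero.iff_id_eq_zero, ← cancel_epi f, comp_id, comp_zero, hf]
  · obtain ⟨Q, p, δ, hT⟩ := hD.exists_distTriang_of_mono f
    rcases hX.2.2 Y.obj Q.obj ⟨Y.property, X.property, Q.property, _, _, _, hT⟩ with h | h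
    · exact absurd ((heartι D).map_injective
        ((h.eq_of_src _ _).trans ((heartι D).map_zero _ _).symm)) hf
    · have : IsIso ((heartι D).map f) := (Triangle.isZero₃_iff_isIso₁ _ hT).1 h
      exact isIso_of_reflects_iso f (heartι D)

lemma exists_hasLength {x : C} (hx : FiniteLengthIn C (heartSet C D) x) :
    letI := hD.heartAbelian
    ∀ h : x ∈ heartSet C D, ∃ n, HasLength n (⟨x, h⟩ : HeartCat D) := by
  let := hD.heartAbelian
  induction hx with
  | zero h₀ =>
    intro h
    refine ⟨0, .zero ((IsZero.iff_id_eq_zero _).2 ?_)⟩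
    exact InducedCategory.hom_ext (h₀.eq_of_src _ _)
  | @step s x q hs _ hE ih =>
    intro h
    obtain ⟨n, hn⟩ := ih hE.2.2.1
    obtain ⟨f, g, w, hS⟩ := hD.exists_shortExact (X := ⟨s, hE.1⟩) (Y := ⟨x, h⟩)
      (Z := ⟨q, hE.2.2.1⟩) hE.isTri
    exact ⟨n + 1, .step hS (hD.simple_of_simpleIn hs) hn⟩

/-- The extension closure of a set of objects of the heart is closed under quotients if it
contains the quotients of its generators. -/
lemma heartExt_of_epi (hS : S ⊆ heartSet C D)
    (hq : letI := hD.heartAbelian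
      ∀ {X Y : HeartCat D} (p : X ⟶ Y) [Epi p], X.obj ∈ S → HeartExt C (heartSet C D) S Y.obj)
    {x : C} (hx : HeartExt C (heartSet C D) S x) :
    letI := hD.heartAbelian
    ∀ {X Y : HeartCat D} (p : X ⟶ Y) [Epi p], X.obj = x →
      HeartExt C (heartSet C D) S Y.obj := by
  let := hD.heartAbelian
  induction hx with
  | of h =>
    rintro X Y p _ rfl
    exact hq p h
  | zero h _ =>
    rintro X Y p _ rfl
    have hX : IsZero X := (IsZero.iff_id_eq_zero _).2 (InducedCategory.hom_ext (h.eq_of_src _ _))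
    exact .zero ((heartι D).map_isZero (hX.of_epi p)) Y.property
  | @iso x y e hy h ih =>
    rintro X Y p _ rfl
    let e' : (⟨x, h.mem hS⟩ : HeartCat D) ≅ X := (heartι D).preimageIso e
    exact ih (e'.hom ≫ p) rfl
  | @ext t x f _ _ hE iht ihf =>
    rintro X Y p _ rfl
    obtain ⟨i, g, w, hS⟩ := hD.exists_shortExact (X := ⟨t, hE.1⟩) (Y := X)
      (Z := ⟨f, hE.2.2.1⟩) hE.isTri
    obtain ⟨S', hS', rfl, ⟨q₁, _⟩, ⟨q₃, _⟩⟩ := exists_shortExact_of_epi hS p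
    exact .ext (iht q₁ rfl) (ihf q₃ rfl) (hD.heartTriangle_of_shortExact hS')

lemma torsionPairIn_heartExt (hfl : ∀ x ∈ heartSet C D, FiniteLengthIn C (heartSet C D) x)
    (hS : S ⊆ heartSet C D)
    (hq : letI := hD.heartAbelian
      ∀ {X Y : HeartCat D} (p : X ⟶ Y) [Epi p], X.obj ∈ S → HeartExt C (heartSet C D) S Y.obj) :
    TorsionPairIn C (heartSet C D) {c | HeartExt C (heartSet C D) S c}
      (perpIn C (heartSet C D) {c | HeartExt C (heartSet C D) S c}) where
  subT _ hx := HeartExt.mem hS hx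
  subF _ hx := hx.1
  isoT e hx := .iso e (hD.heart_of_iso e (HeartExt.mem hS hx)) hx
  isoF e hx := ⟨hD.heart_of_iso e hx.1,
    fun t ht ↦ HomZero.of_iso (hx.2 t ht) (Iso.refl _) e.symm⟩
  hom_zero t ht _ hf := hf.2 t ht
  exists_ses x hx := by
    let := hD.heartAbelian
    obtain ⟨n, hn⟩ := hD.exists_hasLength (hfl x hx) hx
    obtain ⟨f, p, _, hp, hf⟩ := exists_torsion_decomposition
      {X : HeartCat D | HeartExt C (heartSet C D) S X.obj}
      (fun X hX ↦ .zero ((heartι D).map_isZero hX) X.property)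
      (fun X Y p _ hX ↦ hD.heartExt_of_epi hS hq hX p rfl)
      (fun _ hE h₁ h₃ ↦ .ext h₁ h₃ (hD.heartTriangle_of_shortExact hE)) n _ hn
    refine ⟨_, hp, f.obj, ⟨f.property, fun t ht φ ↦ ?_⟩,
      hD.heartTriangle_of_shortExact (shortExact_kernel p)⟩
    exact congrArg InducedCategory.Hom.hom
      (hf ⟨t, HeartExt.mem hS ht⟩ ht (InducedCategory.homMk φ))

lemma torsion_of_epi (hT : TorsionPairIn C (heartSet C D) T F) :
    letI := hD.heartAbelian
    ∀ {X Y : HeartCat D} (p : X ⟶ Y) [Epi p], X.obj ∈ T → Y.obj ∈ T := by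
  let := hD.heartAbelian
  intro X Y p _ hX
  refine hT.mem_of_homZero hD Y.property fun f hf φ ↦ ?_
  let φ' : Y ⟶ (⟨f, hf.1⟩ : HeartCat D) := InducedCategory.homMk φ
  have h : p ≫ φ' = 0 := InducedCategory.hom_ext (hf.2 _ hX _)
  exact congrArg InducedCategory.Hom.hom ((cancel_epi p).1 (h.trans comp_zero.symm))

/-- A quotient in the heart of a simple object `a` of the left tilt at a torsion class is either
torsion or isomorphic to `a`. -/
lemma mem_or_iso_of_epi (hT : TorsionPairIn C (heartSet C D) T F) {a : C}
    (ha : SimpleIn C (leftTilt C (heartSet C D) T) a) :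
    letI := hD.heartAbelian
    ∀ {X Y : HeartCat D} (p : X ⟶ Y) [Epi p], X.obj = a → Y.obj ∈ T ∨ Nonempty (a ≅ Y.obj) := by
  let := hD.heartAbelian
  rintro X Y p _ rfl
  obtain ⟨t, ht, f, hf, hE⟩ := hT.exists_ses Y.obj Y.property
  obtain ⟨i, q, w, hS⟩ := hD.exists_shortExact (X := ⟨t, hE.1⟩) (Y := Y)
    (Z := ⟨f, hE.2.2.1⟩) hE.isTri
  have : Epi q := hS.epi_g
  have hE' := hD.heartTriangle_of_shortExact (shortExact_kernel (p ≫ q))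
  have hX := mem_perpIn_of_mem_leftTilt hD hT.subT ha.1 X.property
  have hK : (kernel (p ≫ q)).obj ∈ perpIn C (heartSet C D) T := by
    refine ⟨(kernel (p ≫ q)).property, fun t' ht' φ ↦ ?_⟩
    let φ' : (⟨t', hT.subT ht'⟩ : HeartCat D) ⟶ kernel (p ≫ q) := InducedCategory.homMk φ
    have h : φ' ≫ kernel.ι (p ≫ q) = 0 := InducedCategory.hom_ext (hX.2 _ ht' _)
    exact congrArg InducedCategory.Hom.hom
      ((cancel_mono (kernel.ι (p ≫ q))).1 (h.trans zero_comp.symm))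
  rcases ha.2.2 _ _ (hE'.isTri.heartTriangle (.of (.inl hK)) ha.1
    (.of (.inl (hT.mem_perpIn hf)))) with h | h
  · have hK₀ : IsZero (kernel (p ≫ q)) :=
      (IsZero.iff_id_eq_zero _).2 (InducedCategory.hom_ext (h.eq_of_src _ _))
    have : Mono (p ≫ q) := Preadditive.mono_of_kernel_zero (hK₀.eq_of_src _ _)
    have : Mono p := mono_of_mono p q
    have : IsIso p := isIso_of_mono_of_epi p
    exact .inr ⟨(heartι D).mapIso (asIso p)⟩
  · obtain ⟨e⟩ := hE.isTri.nonempty_iso₁₂ (fun _ ↦ h.eq_of_tgt _ _) (fun _ ↦ h.eq_of_tgt _ _)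
    exact .inl (hT.isoT e ht)

lemma torsionPairIn_insert (hfl : ∀ x ∈ heartSet C D, FiniteLengthIn C (heartSet C D) x)
    (hS : S ⊆ heartSet C D)
    (hT : TorsionPairIn C (heartSet C D) {c | HeartExt C (heartSet C D) S c} F) {a : C}
    (ha : a ∈ heartSet C D)
    (ha' : SimpleIn C (leftTilt C (heartSet C D) {c | HeartExt C (heartSet C D) S c}) a) :
    TorsionPairIn C (heartSet C D) {c | HeartExt C (heartSet C D) (insert a S) c}
      (perpIn C (heartSet C D) {c | HeartExt C (heartSet C D) (insert a S) c}) := by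
  refine hD.torsionPairIn_heartExt hfl (Set.insert_subset ha hS) fun {X Y} p _ hX ↦ ?_
  rcases hX with hX | hX
  · rcases hD.mem_or_iso_of_epi hT ha' p hX with h | ⟨⟨e⟩⟩
    · exact HeartExt.mono (Set.subset_insert a S) h
    · exact .iso e Y.property (.of (Set.mem_insert a S))
  · exact HeartExt.mono (Set.subset_insert a S) (hD.torsion_of_epi hT p (.of hX))

lemma torsionPairIn_empty :
    TorsionPairIn C (heartSet C D) {c | HeartExt C (heartSet C D) ∅ c} (heartSet C D) where
  subT _ hx := HeartExt.mem (Set.empty_subset _) hx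
  subF _ hx := hx
  isoT e hx := .iso e (hD.heart_of_iso e (HeartExt.mem (Set.empty_subset _) hx)) hx
  isoF e hx := hD.heart_of_iso e hx
  hom_zero _ ht _ _ := HeartExt.homZero (by simp) ht
  exists_ses x hx := by
    obtain ⟨z, hz⟩ := HasZeroObject.zero (C := C)
    have hz' := hD.heart_of_isZero hz
    exact ⟨z, .zero hz hz', x, hx, (isTri_of_isZero_left hz).heartTriangle hz' hx hx⟩

lemma leftTilt_empty :
    leftTilt C (heartSet C D) {c | HeartExt C (heartSet C D) ∅ c} = heartSet C D := by
  ext c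
  refine ⟨fun hc ↦ ?_, fun hc ↦ .of (.inl ⟨hc, fun t ht ↦ HeartExt.homZero (by simp) ht⟩)⟩
  induction hc with
  | @of c hc =>
    rcases hc with hc | hc
    · exact hc.1
    · have hz : IsZero (c⟦(1 : ℤ)⟧) := HeartExt.isZero_of_empty (mem_shiftSet_neg_one.1 hc)
      exact hD.heart_of_isZero ((Functor.map_isZero (CategoryTheory.shiftFunctor C (-1 : ℤ))
        hz).of_iso (shiftNegIso c 1 (-1) (by simp)).symm)
  | zero hc => exact hD.heart_of_isZero hc
  | iso e _ ih => exact hD.heart_of_iso e ih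
  | ext f g k hE _ _ iha ihc => exact hD.heart_of_isTri ⟨f, g, k, hE⟩ iha ihc

end IsTStructure

end IteratedTilt

/-- an iterated simple left tilt at objects `a₀, …, a_{N-1}` of `A`, each
`a_i` being simple in the `i`-th iterated tilt, equals the single left tilt at the
torsion class `T = ⟨a₀, …, a_{N-1}⟩`, which is indeed a torsion class in `A`. -/
theorem iterated_simple_tilts_eq_tilt (D : Set C) (hD : IsTStructure C D)
    (hDb : IsBounded C D)
    (hfl : ∀ x ∈ heartSet C D, FiniteLengthIn C (heartSet C D) x)
    (N : ℕ) (a : Fin N → C) (ha : ∀ i, a i ∈ heartSet C D)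
    (B : Fin (N + 1) → Set C) (hB0 : B 0 = heartSet C D)
    (hBfl : ∀ i, ∀ x ∈ B i, FiniteLengthIn C (B i) x)
    (hsimple : ∀ i : Fin N, SimpleIn C (B i.castSucc) (a i))
    (hstep : ∀ i : Fin N,
      B i.succ = leftTilt C (B i.castSucc) {c : C | HeartExt C (B i.castSucc) {a i} c}) :
    (∃ F : Set C,
      TorsionPairIn C (heartSet C D)
        {c : C | HeartExt C (heartSet C D) (Set.range a) c} F) ∧
    B (Fin.last N) =
      leftTilt C (heartSet C D) {c : C | HeartExt C (heartSet C D) (Set.range a) c} := by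
  have key (i : Fin (N + 1)) : ∃ S : Set C, S = Set.image a {j | j.castSucc < i} ∧
      (∃ F, TorsionPairIn C (heartSet C D) {c | HeartExt C (heartSet C D) S c} F) ∧
      B i = leftTilt C (heartSet C D) {c | HeartExt C (heartSet C D) S c} := by
    induction i using Fin.induction with
    | zero => exact ⟨∅, by simp, ⟨_, hD.torsionPairIn_empty⟩, by rw [hB0, hD.leftTilt_empty]⟩
    | succ i ih =>
      obtain ⟨S, hS, ⟨F, hF⟩, hB⟩ := ih
      have hSA : S ⊆ heartSet C D := by
        rintro _ hs
        obtain ⟨j, -, rfl⟩ := hS ▸ hs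
        exact ha j
      have hs := hsimple i
      rw [hB] at hs
      refine ⟨insert (a i) S, ?_, ⟨_, hD.torsionPairIn_insert hfl hSA hF (ha i) hs⟩, ?_⟩
      · rw [hS, ← Set.image_insert_eq]
        congr 1
        ext j
        simp [Fin.castSucc_lt_succ_iff, le_iff_eq_or_lt]
      · rw [hstep i, hB, leftTilt_leftTilt hD hSA (ha i) hF hs.1]
  obtain ⟨S, hS, h⟩ := key (Fin.last N)
  obtain rfl : S = Set.range a := by simp [hS, Fin.castSucc_lt_last]
  exact h

end Paper
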